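/- arXiv:2404.12456 — 6 statements merged into one kernel-verified Lean document; each statement's English description precedes it below -/
import Mathlib

section
/- Let C be a category, S a set, and A an object of C such that C has the relevant S-indexed coproducts. Let f : A → ∐_{i∈S} A be a decomposing morphism. Then the fork consisting of f : A → ∐_{i∈S} A together with the parallel pair ∐_{i∈S} f, ∐_{i∈S} ι_i : ∐_{i∈S} A ⇉ ∐_{i∈S} ∐_{j∈S} A is a split equalizer: the codiagonal ∇ : ∐_{i∈S} A → A satisfies ∇ ∘ f = id_A, and the 'outer' codiagonal ∇̄ : ∐_{i∈S} ∐_{j∈S} A → ∐_{j∈S} A (which collapses the outer coproduct, i.e. restricts to the identity of ∐_{j∈S} A on each outer summand) satisfies ∇̄ ∘ (∐_{i∈S} ι_i) = id and ∇̄ ∘ (∐_{i∈S} f) = f ∘ ∇. In particular, f exhibits A as an equalizer of the pair (∐_{i∈S} f, ∐_{i∈S} ι_i). -/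
open CategoryTheory CategoryTheory.Limits

universe w v u

/-- A morphism `f : A ⟶ ∐_{i∈S} A` is *decomposing* if
`(∐_i f) ∘ f = (∐_i ι_i) ∘ f` and `∇ ∘ f = id_A`. -/
def IsDecomposing {C : Type u} [Category.{v} C] {S : Type w} {A : C}
    [HasCoproduct (fun _ : S => A)]
    [HasCoproduct (fun _ : S => ∐ (fun _ : S => A))]
    (f : A ⟶ ∐ (fun _ : S => A)) : Prop :=
  (f ≫ Limits.Sigma.map (fun _ : S => f) =
      f ≫ Limits.Sigma.map (fun i : S => Sigma.ι (fun _ : S => A) i)) ∧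
  f ≫ Sigma.desc (fun _ : S => 𝟙 A) = 𝟙 A

theorem decomposing_is_split_equalizer {C : Type u} [Category.{v} C] {S : Type w} {A : C}
    [HasCoproduct (fun _ : S => A)]
    [HasCoproduct (fun _ : S => ∐ (fun _ : S => A))]
    (f : A ⟶ ∐ (fun _ : S => A)) (hf : IsDecomposing f) :
    -- `∇ ∘ f = id_A`
    (f ≫ Sigma.desc (fun _ : S => 𝟙 A) = 𝟙 A) ∧
    -- `∇̄ ∘ (∐_i ι_i) = id`
    (Limits.Sigma.map (fun i : S => Sigma.ι (fun _ : S => A) i) ≫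
        Sigma.desc (fun _ : S => 𝟙 (∐ (fun _ : S => A))) = 𝟙 (∐ (fun _ : S => A))) ∧
    -- `∇̄ ∘ (∐_i f) = f ∘ ∇`
    (Limits.Sigma.map (fun _ : S => f) ≫ Sigma.desc (fun _ : S => 𝟙 (∐ (fun _ : S => A))) =
        Sigma.desc (fun _ : S => 𝟙 A) ≫ f) ∧
    -- in particular, `f` exhibits `A` as an equalizer of `(∐_i f, ∐_i ι_i)`
    Nonempty (IsLimit (Fork.ofι f hf.1)) := by
  have h_inner : Limits.Sigma.map (fun i : S => Sigma.ι (fun _ : S => A) i) ≫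
      Sigma.desc (fun _ : S => 𝟙 (∐ (fun _ : S => A))) = 𝟙 (∐ (fun _ : S => A)) :=
    Sigma.hom_ext _ _ fun i => by simp
  have h_outer : Limits.Sigma.map (fun _ : S => f) ≫
      Sigma.desc (fun _ : S => 𝟙 (∐ (fun _ : S => A))) = Sigma.desc (fun _ : S => 𝟙 A) ≫ f :=
    Sigma.hom_ext _ _ fun i => by simp
  let split : IsSplitEqualizer (Limits.Sigma.map (fun _ : S => f))
      (Limits.Sigma.map (fun i : S => Sigma.ι (fun _ : S => A) i)) f :=
    { leftRetraction := Sigma.desc (fun _ : S => 𝟙 A)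
      rightRetraction := Sigma.desc (fun _ : S => 𝟙 (∐ (fun _ : S => A)))
      condition := hf.1
      ι_leftRetraction := hf.2
      bottom_rightRetraction := h_inner
      top_rightRetraction := h_outer }
  exact ⟨hf.2, h_inner, h_outer, ⟨split.isEqualizer⟩⟩
end

section
/- Let C be a preadditive category, S a set, and A an object of C such that C has S-indexed coproducts of copies of A. Let f : A → ∐_{i∈S} A be a decomposing morphism, fix j ∈ S, and suppose the equalizer e : E → A of the parallel pair (f, ι_j) exists. Let p : ∐_{i∈S} A → A denote the j-th projection, i.e. the morphism whose restriction to the j-th summand is id_A and whose restriction to every other summand is the zero morphism. Then there exists a (necessarily unique) morphism s : A → E with e ∘ s = p ∘ f, and this s satisfies s ∘ e = id_E; hence the equalizer of (f, ι_j) is a split equalizer. -/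
open CategoryTheory CategoryTheory.Limits

universe w v u

/-- In a preadditive category, a family of morphisms out of `A` followed by the projection onto
the `j`-th summand is the projection of `∐_{i∈S} A` onto the `j`-th summand followed by the `j`-th
morphism of the family. -/
theorem sigma_map_desc_dite {C : Type u} [Category.{v} C] [Preadditive C] {S : Type w}
    [DecidableEq S] {A B : C} [HasCoproduct (fun _ : S => A)] [HasCoproduct (fun _ : S => B)]
    (g : S → (A ⟶ B)) (j : S) :
    Limits.Sigma.map g ≫ Sigma.desc (fun i : S => if _ : i = j then 𝟙 B else 0) =
      Sigma.desc (fun i : S => if _ : i = j then 𝟙 A else 0) ≫ g j := by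
  refine Sigma.hom_ext _ _ fun i => ?_
  by_cases h : i = j
  · subst h
    simp
  · simp [h]

/-- A decomposing morphism `f` followed by the `j`-th projection equalizes `f` and `ι_j`. -/
theorem IsDecomposing.comp_proj_condition {C : Type u} [Category.{v} C] [Preadditive C]
    {S : Type w} [DecidableEq S] {A : C} [HasCoproduct (fun _ : S => A)]
    [HasCoproduct (fun _ : S => ∐ (fun _ : S => A))]
    {f : A ⟶ ∐ (fun _ : S => A)} (hf : IsDecomposing f) (j : S) :
    (f ≫ Sigma.desc (fun i : S => if _ : i = j then 𝟙 A else 0)) ≫ f =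
      (f ≫ Sigma.desc (fun i : S => if _ : i = j then 𝟙 A else 0)) ≫
        Sigma.ι (fun _ : S => A) j := by
  have h := hf.1 =≫ Sigma.desc (fun i : S => if _ : i = j then 𝟙 (∐ (fun _ : S => A)) else 0)
  rw [Category.assoc, Category.assoc] at h
  rw [Category.assoc, Category.assoc]
  exact (f ≫= sigma_map_desc_dite (fun _ => f) j).symm.trans
    (h.trans (f ≫= sigma_map_desc_dite (fun i => Sigma.ι (fun _ : S => A) i) j))

/-- In a preadditive category, the equalizer of a decomposing morphism `f` with a
coprojection `ι_j` is split: writing `p` for the `j`-th projection, there is a unique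
`s` with `e ∘ s = p ∘ f`, and it satisfies `s ∘ e = id`. -/
theorem decomposing_equalizer_split_in_preadditive
    {C : Type u} [Category.{v} C] [Preadditive C] {S : Type w} [DecidableEq S] {A : C}
    [HasCoproduct (fun _ : S => A)]
    [HasCoproduct (fun _ : S => ∐ (fun _ : S => A))]
    (f : A ⟶ ∐ (fun _ : S => A)) (hf : IsDecomposing f) (j : S)
    (c : Fork f (Sigma.ι (fun _ : S => A) j)) (hc : IsLimit c) :
    ∃ s : A ⟶ c.pt,
      (s ≫ c.ι = f ≫ Sigma.desc (fun i : S => if h : i = j then 𝟙 A else 0)) ∧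
      (c.ι ≫ s = 𝟙 c.pt) ∧
      ∀ s' : A ⟶ c.pt,
        s' ≫ c.ι = f ≫ Sigma.desc (fun i : S => if h : i = j then 𝟙 A else 0) → s' = s := by
  refine ⟨Fork.IsLimit.lift hc _ (hf.comp_proj_condition j), Fork.IsLimit.lift_ι' hc _ _, ?_,
    fun s' hs' => Fork.IsLimit.hom_ext hc (hs'.trans (Fork.IsLimit.lift_ι' hc _ _).symm)⟩
  apply Fork.IsLimit.hom_ext hc
  rw [Category.assoc, Fork.IsLimit.lift_ι', c.condition_assoc]
  simp
end

section
/- Let C be a preadditive category, S a set, and A an object of C such that C has S-indexed coproducts of copies of A. Let f : A → ∐_{i∈S} A be a decomposing morphism, fix j ∈ S, and let e : E → A be an equalizer of the parallel pair (f, ι_j). Then for any category D and any functor F : C → D, the morphism F(e) : F(E) → F(A) is an equalizer of the parallel pair (F(f), F(ι_j)). In other words, decomposing equalizers in a preadditive category are absolute: they are preserved by arbitrary functors. -/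
open CategoryTheory CategoryTheory.Limits

universe w v u v₂ u₂

open Classical in
/-- Projecting `∐_i g_i` onto the `j`-th summand gives `g_j`. -/
lemma sigmaMap_π {C : Type u} [Category.{v} C] [HasZeroMorphisms C] {S : Type w}
    {X Y : S → C} [HasCoproduct X] [HasCoproduct Y] (g : ∀ i, X i ⟶ Y i) (j : S) :
    Limits.Sigma.map g ≫ Sigma.π Y j = Sigma.π X j ≫ g j := by
  refine Sigma.hom_ext _ _ fun i => ?_
  obtain rfl | h := eq_or_ne i j
  · simp
  · simp [Sigma.ι_π_of_ne, Sigma.ι_π_of_ne_assoc, h]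

open Classical in
/-- The `j`-th component of a decomposing morphism equalizes it with the `j`-th coprojection. -/
lemma IsDecomposing.π_condition {C : Type u} [Category.{v} C] [HasZeroMorphisms C]
    {S : Type w} {A : C} [HasCoproduct (fun _ : S => A)]
    [HasCoproduct (fun _ : S => ∐ (fun _ : S => A))]
    {f : A ⟶ ∐ (fun _ : S => A)} (hf : IsDecomposing f) (j : S) :
    (f ≫ Sigma.π (fun _ : S => A) j) ≫ f =
      (f ≫ Sigma.π (fun _ : S => A) j) ≫ Sigma.ι (fun _ : S => A) j := by
  have h := hf.1 =≫ Sigma.π (fun _ : S => ∐ (fun _ : S => A)) j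
  simpa only [Category.assoc, sigmaMap_π] using h

open Classical in
/-- A decomposing equalizer in a category with zero morphisms is a split equalizer. -/
noncomputable def IsDecomposing.isSplitEqualizer {C : Type u} [Category.{v} C]
    [HasZeroMorphisms C] {S : Type w} {A : C} [HasCoproduct (fun _ : S => A)]
    [HasCoproduct (fun _ : S => ∐ (fun _ : S => A))]
    {f : A ⟶ ∐ (fun _ : S => A)} (hf : IsDecomposing f) (j : S)
    {c : Fork f (Sigma.ι (fun _ : S => A) j)} (hc : IsLimit c) :
    IsSplitEqualizer f (Sigma.ι (fun _ : S => A) j) c.ι where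
  leftRetraction := Fork.IsLimit.lift hc _ (hf.π_condition j)
  rightRetraction := Sigma.π (fun _ : S => A) j
  condition := c.condition
  ι_leftRetraction := Fork.IsLimit.hom_ext hc <| by
    rw [Category.assoc, Fork.IsLimit.lift_ι', c.condition_assoc, Sigma.ι_π_eq_id]
    exact (Category.comp_id _).trans (Category.id_comp _).symm
  bottom_rightRetraction := Sigma.ι_π_eq_id _ j
  top_rightRetraction := (Fork.IsLimit.lift_ι' hc _ _).symm

/-- Decomposing equalizers in a preadditive category are absolute: they are preserved by
arbitrary functors. -/
theorem decomposing_equalizer_absolute_in_preadditive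
    {C : Type u} [Category.{v} C] [Preadditive C] {S : Type w} {A : C}
    [HasCoproduct (fun _ : S => A)]
    [HasCoproduct (fun _ : S => ∐ (fun _ : S => A))]
    (f : A ⟶ ∐ (fun _ : S => A)) (hf : IsDecomposing f) (j : S)
    (c : Fork f (Sigma.ι (fun _ : S => A) j)) (hc : IsLimit c)
    {D : Type u₂} [Category.{v₂} D] (F : C ⥤ D) :
    Nonempty (IsLimit (Fork.ofι (F.map c.ι)
      (show F.map c.ι ≫ F.map f = F.map c.ι ≫ F.map (Sigma.ι (fun _ : S => A) j) by
        rw [← F.map_comp, ← F.map_comp, c.condition]))) := by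
  exact ⟨((hf.isSplitEqualizer j hc).map F).isEqualizer⟩
end

section
/- Let (V, ⊗, I) be a monoidal category whose underlying category is preadditive, has a zero object, and has all small coproducts. Then V is decomposing, i.e.: (a) coproducts commute with decomposing equalizers: for any sets T and S, any family (f_t : A_t → ∐_{i∈S} A_t)_{t∈T} of decomposing morphisms, any j ∈ S, and any family of equalizers e_t : E_t → A_t of the pairs (f_t, ι_j), the morphism ∐_{t∈T} e_t : ∐_{t∈T} E_t → ∐_{t∈T} A_t is an equalizer of the parallel pair (∐_{t∈T} f_t, ∐_{t∈T} ι_j) : ∐_{t∈T} A_t ⇉ ∐_{t∈T} ∐_{i∈S} A_t; (b) coproducts in V are disjoint: coprojections are monomorphisms and for i ≠ j the pullback of the coprojections ι_i and ι_j into a coproduct is the zero object; (c) the monoidal product preserves decomposing equalizers in each variable: for any decomposing morphism f : A → ∐_{i∈S} A, any j ∈ S, any equalizer e : E → A of (f, ι_j), and any object B of V, the morphism id_B ⊗ e is an equalizer of (id_B ⊗ f, id_B ⊗ ι_j) and the morphism e ⊗ id_B is an equalizer of (f ⊗ id_B, ι_j ⊗ id_B). -/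
open CategoryTheory CategoryTheory.Limits ZeroObject MonoidalCategory

universe w v u

section Defs

variable (C : Type u) [Category.{v} C] [HasCoproducts.{w} C]

/-- Coproducts commute with decomposing equalizers: for any family of decomposing
morphisms `f t : A t ⟶ ∐_{i∈S} A t`, any `j ∈ S` and any family of equalizers
`e t : E t ⟶ A t` of `(f t, ι_j)`, the coproduct `∐_t e t` is an equalizer of
`(∐_t f t, ∐_t ι_j)`. -/
def CoprodCommutesWithDecompEqualizers : Prop :=
  ∀ (T S : Type w) (A : T → C) (f : ∀ t, A t ⟶ ∐ (fun _ : S => A t)),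
    (∀ t, IsDecomposing (f t)) → ∀ (j : S) (E : T → C) (e : ∀ t, E t ⟶ A t)
    (hw : ∀ t, e t ≫ f t = e t ≫ Sigma.ι (fun _ : S => A t) j),
    (∀ t, Nonempty (IsLimit (Fork.ofι (e t) (hw t)))) →
    Nonempty (IsLimit (Fork.ofι (Limits.Sigma.map e)
      (show Limits.Sigma.map e ≫ Limits.Sigma.map f =
          Limits.Sigma.map e ≫ Limits.Sigma.map (fun t => Sigma.ι (fun _ : S => A t) j) by
        ext t
        simp [reassoc_of% hw t])))

end Defs

/-- The equalizer of a decomposing morphism `f` with a coprojection `ι_j` is split: the `j`-th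
component of `f` factors through it. -/
theorem IsDecomposing.nonempty_isSplitEqualizer {C : Type u} [Category.{v} C]
    [HasZeroMorphisms C] {S : Type w} {A E : C}
    [HasCoproduct (fun _ : S => A)] [HasCoproduct (fun _ : S => ∐ (fun _ : S => A))]
    {f : A ⟶ ∐ (fun _ : S => A)} (hf : IsDecomposing f) {j : S} {e : E ⟶ A}
    {hw : e ≫ f = e ≫ Sigma.ι (fun _ : S => A) j} (he : IsLimit (Fork.ofι e hw)) :
    Nonempty (IsSplitEqualizer f (Sigma.ι (fun _ : S => A) j) e) := by
  classical
  have hmap (g : S → (A ⟶ ∐ (fun _ : S => A))) :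
      Limits.Sigma.map g ≫ Sigma.π (fun _ : S => ∐ (fun _ : S => A)) j =
        Sigma.π (fun _ : S => A) j ≫ g j := by
    ext i
    by_cases h : i = j
    · subst h; simp
    · simp [Sigma.ι_π_of_ne_assoc _ h, Sigma.ι_π_of_ne _ h]
  have hj : (f ≫ Sigma.π (fun _ : S => A) j) ≫ f =
      (f ≫ Sigma.π (fun _ : S => A) j) ≫ Sigma.ι (fun _ : S => A) j := by
    have := hf.1 =≫ Sigma.π (fun _ : S => ∐ (fun _ : S => A)) j
    simpa [hmap] using this
  have hs : Fork.IsLimit.lift he _ hj ≫ e = f ≫ Sigma.π (fun _ : S => A) j :=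
    Fork.IsLimit.lift_ι' he _ hj
  exact ⟨{
    leftRetraction := Fork.IsLimit.lift he _ hj
    rightRetraction := Sigma.π (fun _ : S => A) j
    condition := hw
    ι_leftRetraction := Fork.IsLimit.hom_ext he (by simp [hs, reassoc_of% hw])
    bottom_rightRetraction := by simp
    top_rightRetraction := hs.symm }⟩

/-- A coproduct of split equalizers is a split equalizer. -/
noncomputable def CategoryTheory.IsSplitEqualizer.sigmaMap {C : Type u} [Category.{v} C]
    {T : Type w} {W X Y : T → C} [HasCoproduct W] [HasCoproduct X] [HasCoproduct Y]
    {f g : ∀ t, X t ⟶ Y t} {e : ∀ t, W t ⟶ X t} (h : ∀ t, IsSplitEqualizer (f t) (g t) (e t)) :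
    IsSplitEqualizer (Limits.Sigma.map f) (Limits.Sigma.map g) (Limits.Sigma.map e) where
  leftRetraction := Limits.Sigma.map fun t => (h t).leftRetraction
  rightRetraction := Limits.Sigma.map fun t => (h t).rightRetraction
  condition := by ext t; simp [reassoc_of% (h t).condition]
  ι_leftRetraction := by ext t; simp
  bottom_rightRetraction := by ext t; simp
  top_rightRetraction := by ext t; simp [reassoc_of% (h t).top_rightRetraction]

/-- Distinct coprojections into a coproduct have the zero object as their pullback. -/
theorem CategoryTheory.Limits.Sigma.isPullback_zero_of_ne {C : Type u} [Category.{v} C]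
    [HasZeroMorphisms C] [HasZeroObject C] {S : Type w} (A : S → C) [HasCoproduct A] {i j : S}
    (hij : i ≠ j) :
    IsPullback (0 : (0 : C) ⟶ A i) (0 : (0 : C) ⟶ A j) (Sigma.ι A i) (Sigma.ι A j) := by
  classical
  refine ⟨⟨by simp⟩, ⟨PullbackCone.IsLimit.mk _ (fun _ => 0) (fun s => ?_) (fun s => ?_)
    (fun _ _ _ _ => HasZeroObject.to_zero_ext _ _)⟩⟩
  · simpa [Sigma.ι_π_of_ne A hij.symm] using (s.condition =≫ Sigma.π A i).symm
  · simpa [Sigma.ι_π_of_ne A hij] using s.condition =≫ Sigma.π A j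

/-- If `V` is a monoidal category which is preadditive, has a zero object and all small
coproducts, then `V` is decomposing: (a) coproducts commute with decomposing equalizers,
(b) coproducts are disjoint, and (c) the monoidal product preserves decomposing
equalizers in each variable. -/
theorem preadditive_monoidal_is_decomposing
    (V : Type u) [Category.{v} V] [MonoidalCategory V] [Preadditive V] [HasZeroObject V]
    [HasCoproducts.{w} V] :
    -- (a) coproducts commute with decomposing equalizers
    CoprodCommutesWithDecompEqualizers.{w} V ∧
    -- (b) coproducts are disjoint
    ((∀ (S : Type w) (A : S → V) (j : S), Mono (Sigma.ι A j)) ∧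
      (∀ (S : Type w) (A : S → V) (i j : S), i ≠ j →
        IsPullback (0 : (0 : V) ⟶ A i) (0 : (0 : V) ⟶ A j) (Sigma.ι A i) (Sigma.ι A j))) ∧
    -- (c) the monoidal product preserves decomposing equalizers in each variable
    (∀ (S : Type w) (A : V) (f : A ⟶ ∐ (fun _ : S => A)), IsDecomposing f →
      ∀ (j : S) (E : V) (e : E ⟶ A)
        (hw : e ≫ f = e ≫ Sigma.ι (fun _ : S => A) j),
        Nonempty (IsLimit (Fork.ofι e hw)) → ∀ B : V,
        Nonempty (IsLimit (Fork.ofι (B ◁ e)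
          (show B ◁ e ≫ B ◁ f = B ◁ e ≫ B ◁ (Sigma.ι (fun _ : S => A) j) by
            rw [← MonoidalCategory.whiskerLeft_comp, hw, MonoidalCategory.whiskerLeft_comp]))) ∧
        Nonempty (IsLimit (Fork.ofι (e ▷ B)
          (show e ▷ B ≫ f ▷ B = e ▷ B ≫ (Sigma.ι (fun _ : S => A) j) ▷ B by
            rw [← MonoidalCategory.comp_whiskerRight, hw,
              MonoidalCategory.comp_whiskerRight])))) := by
  classical
  refine ⟨fun T S A f hf j E e hw he => ?_, ⟨fun S A j => ?_, fun S A i j hij =>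
    Sigma.isPullback_zero_of_ne A hij⟩, fun S A f hf j E e hw ⟨he⟩ B => ?_⟩
  · exact ⟨(IsSplitEqualizer.sigmaMap fun t =>
      ((hf t).nonempty_isSplitEqualizer (he t).some).some).isEqualizer⟩
  · exact mono_of_mono_fac (Sigma.ι_π_eq_id A j)
  · obtain ⟨h⟩ := hf.nonempty_isSplitEqualizer he
    exact ⟨⟨(h.map (tensorLeft B)).isEqualizer⟩, ⟨(h.map (tensorRight B)).isEqualizer⟩⟩
end

section
/- Let V be a category with a terminal object 1, small coproducts, equalizers and pullbacks. For a set S, write F(S) = ∐_{a∈S} 1, and let Φ_S : V^S → V/F(S) be the functor sending a family (A_a)_{a∈S} to the object ∐_{a∈S} A_a of the over category V/F(S), equipped with the structure morphism ∐_{a∈S} A_a → ∐_{a∈S} 1 = F(S) whose restriction to the a-th summand is the terminal map A_a → 1 followed by the a-th coprojection; Φ_S acts on morphisms by taking coproducts. Suppose that Φ_S is an equivalence of categories for every set S. Then for every set S the S-indexed coproduct functor V^S → V preserves equalizers and pullbacks: given an S-indexed family of equalizer (respectively pullback) diagrams in V, the diagram obtained by taking S-indexed coproducts pointwise is again an equalizer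 (respectively pullback) diagram. -/
open CategoryTheory CategoryTheory.Limits

universe w v u

/-- The comparison functor `Φ_S : V^S ⥤ V/F(S)`, where `F(S) = ∐_{a∈S} 1`, sending a
family `(A_a)_a` to `∐_a A_a` equipped with the coproduct of the terminal maps. -/
noncomputable def Phi (V : Type u) [Category.{v} V] [HasTerminal V] [HasCoproducts.{w} V]
    (S : Type w) : (S → V) ⥤ Over (∐ (fun _ : S => (⊤_ V))) where
  obj A := Over.mk (Limits.Sigma.map fun a => terminal.from (A a))
  map {A B} φ := Over.homMk (Limits.Sigma.map φ) (by
    dsimp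
    rw [Limits.Sigma.map_comp_map]
    congr 1
    funext a
    exact terminal.hom_ext _ _)

namespace CategoryTheory.pi

variable {I : Type*} {C : I → Type*} [∀ i, Category (C i)]

/-- A family of equalizer diagrams is an equalizer diagram in the product category. -/
def isLimitForkOfEval {E A B : ∀ i, C i} {e : E ⟶ A} {u v : A ⟶ B}
    (hw : ∀ i, e i ≫ u i = e i ≫ v i)
    (h : ∀ i, IsLimit (Fork.ofι (e i) (hw i))) :
    IsLimit (Fork.ofι e (show e ≫ u = e ≫ v from funext hw)) :=
  Fork.IsLimit.mk _
    (fun s i => Fork.IsLimit.lift (h i) (s.ι i) (congr_fun s.condition i))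
    (fun s => funext fun i =>
      Fork.IsLimit.lift_ι' (h i) (s.ι i) (congr_fun s.condition i))
    (fun s _ hm => funext fun i => Fork.IsLimit.hom_ext (h i)
      ((congr_fun hm i).trans
        (Fork.IsLimit.lift_ι' (h i) (s.ι i) (congr_fun s.condition i)).symm))

/-- A family of pullback squares is a pullback square in the product category. -/
theorem isPullback_of_eval {P X Y Z : ∀ i, C i} {fst : P ⟶ X} {snd : P ⟶ Y} {f : X ⟶ Z}
    {g : Y ⟶ Z} (h : ∀ i, IsPullback (fst i) (snd i) (f i) (g i)) :
    IsPullback fst snd f g :=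
  ⟨⟨funext fun i => (h i).w⟩, ⟨PullbackCone.IsLimit.mk _
    (fun s i => (h i).lift (s.fst i) (s.snd i) (congr_fun s.condition i))
    (fun _ => funext fun i => (h i).lift_fst _ _ _)
    (fun _ => funext fun i => (h i).lift_snd _ _ _)
    (fun _ _ h₁ h₂ => funext fun i => (h i).hom_ext
      ((congr_fun h₁ i).trans ((h i).lift_fst _ _ _).symm)
      ((congr_fun h₂ i).trans ((h i).lift_snd _ _ _).symm))⟩⟩

end CategoryTheory.pi

/-- If `Phi V S` is an equivalence, then the `S`-indexed coproduct functor preserves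
connected limits. -/
theorem preservesLimitsOfShape_Phi_comp_forget (V : Type u) [Category.{v} V] [HasTerminal V]
    [HasCoproducts.{w} V] (S : Type w) [(Phi.{w} V S).IsEquivalence]
    (J : Type*) [Category J] [IsConnected J] :
    PreservesLimitsOfShape J (Phi.{w} V S ⋙ Over.forget _) :=
  have : PreservesLimitsOfShape J (Over.forget (∐ fun _ : S => ⊤_ V)) :=
    inferInstanceAs (PreservesLimitsOfShape J (CostructuredArrow.proj (𝟭 V) _))
  comp_preservesLimitsOfShape _ _

theorem coproducts_commute_with_equalizers_and_pullbacks_of_Phi_equivalence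
    (V : Type u) [Category.{v} V] [HasTerminal V] [HasCoproducts.{w} V]
    [HasEqualizers V] [HasPullbacks V]
    (hPhi : ∀ S : Type w, (Phi.{w} V S).IsEquivalence) (S : Type w) :
    -- coproducts commute with equalizers
    (∀ (E A B : S → V) (e : ∀ a, E a ⟶ A a) (u v : ∀ a, A a ⟶ B a)
      (hw : ∀ a, e a ≫ u a = e a ≫ v a),
      (∀ a, Nonempty (IsLimit (Fork.ofι (e a) (hw a)))) →
      Nonempty (IsLimit (Fork.ofι (Limits.Sigma.map e)
        (show Limits.Sigma.map e ≫ Limits.Sigma.map u =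
            Limits.Sigma.map e ≫ Limits.Sigma.map v by
          ext a; simp [reassoc_of% hw a])))) ∧
    -- coproducts commute with pullbacks
    (∀ (P X Y Z : S → V) (fst : ∀ a, P a ⟶ X a) (snd : ∀ a, P a ⟶ Y a)
      (f : ∀ a, X a ⟶ Z a) (g : ∀ a, Y a ⟶ Z a),
      (∀ a, IsPullback (fst a) (snd a) (f a) (g a)) →
      IsPullback (Limits.Sigma.map fst) (Limits.Sigma.map snd)
        (Limits.Sigma.map f) (Limits.Sigma.map g)) := by
  have := hPhi S
  constructor
  · intro E A B e u v hw h
    have := preservesLimitsOfShape_Phi_comp_forget V S WalkingParallelPair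
    exact ⟨isLimitForkMapOfIsLimit (Phi.{w} V S ⋙ Over.forget _) _
      (pi.isLimitForkOfEval hw fun a => (h a).some)⟩
  · intro P X Y Z fst snd f g h
    have := preservesLimitsOfShape_Phi_comp_forget V S WalkingCospan
    exact (pi.isPullback_of_eval h).map (Phi.{w} V S ⋙ Over.forget _)
end

section
/- Let C, D, E be categories and F : C × D → E a functor (a bifunctor, functorial in each variable). Let e : E_1 → A together with the parallel pair u, v : A ⇉ B be a coreflexive equalizer in C (so u ∘ e = v ∘ e, e is an equalizer of (u, v), and there exists r : B → A with r ∘ u = id_A = r ∘ v), and let e' : E_2 → A' together with u', v' : A' ⇉ B' be a coreflexive equalizer in D (with common retraction r' : B' → A'). Suppose that for every object d of D the functor F(−, d) sends the fork (e; u, v) to an equalizer in E, and for every object c of C the functor F(c, −) sends the fork (e'; u', v') to an equalizer in E. Then F(e, e') : F(E_1, E_2) → F(A, A') is an equalizer of the parallel pair F(u, u'), F(v, v') : F(A, A') ⇉ F(B, B'). In other words, a bifunctor preserving coreflexive equalizers in each variable separately preserves them in both variables simultaneously. -/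
open CategoryTheory CategoryTheory.Limits

universe v₁ u₁ v₂ u₂ v₃ u₃

/-- A bifunctor `F : C × D ⥤ E` which preserves coreflexive equalizers in each variable
separately preserves them in both variables simultaneously. -/
theorem bifunctor_preserves_coreflexive_equalizers
    {C : Type u₁} [Category.{v₁} C] {D : Type u₂} [Category.{v₂} D]
    {E : Type u₃} [Category.{v₃} E] (F : C × D ⥤ E)
    -- a coreflexive equalizer in `C`
    {E₁ A B : C} (e : E₁ ⟶ A) (u v : A ⟶ B) (hu : e ≫ u = e ≫ v)
    (hlim : IsLimit (Fork.ofι e hu))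
    (r : B ⟶ A) (hr₁ : u ≫ r = 𝟙 A) (hr₂ : v ≫ r = 𝟙 A)
    -- a coreflexive equalizer in `D`
    {E₂ A' B' : D} (e' : E₂ ⟶ A') (u' v' : A' ⟶ B') (hu' : e' ≫ u' = e' ≫ v')
    (hlim' : IsLimit (Fork.ofι e' hu'))
    (r' : B' ⟶ A') (hr₁' : u' ≫ r' = 𝟙 A') (hr₂' : v' ≫ r' = 𝟙 A')
    -- `F(-, d)` sends the first fork to an equalizer, for every `d : D`
    (hF₁ : ∀ d : D, Nonempty (IsLimit (Fork.ofι
      (F.map ((e, 𝟙 d) : ((E₁, d) : C × D) ⟶ (A, d)))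
      (show F.map ((e, 𝟙 d) : ((E₁, d) : C × D) ⟶ (A, d)) ≫
            F.map ((u, 𝟙 d) : ((A, d) : C × D) ⟶ (B, d)) =
          F.map ((e, 𝟙 d) : ((E₁, d) : C × D) ⟶ (A, d)) ≫
            F.map ((v, 𝟙 d) : ((A, d) : C × D) ⟶ (B, d)) by
        rw [← F.map_comp, ← F.map_comp]
        congr 1
        exact Prod.ext hu (by simp)))))
    -- `F(c, -)` sends the second fork to an equalizer, for every `c : C`
    (hF₂ : ∀ c : C, Nonempty (IsLimit (Fork.ofι
      (F.map ((𝟙 c, e') : ((c, E₂) : C × D) ⟶ (c, A')))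
      (show F.map ((𝟙 c, e') : ((c, E₂) : C × D) ⟶ (c, A')) ≫
            F.map ((𝟙 c, u') : ((c, A') : C × D) ⟶ (c, B')) =
          F.map ((𝟙 c, e') : ((c, E₂) : C × D) ⟶ (c, A')) ≫
            F.map ((𝟙 c, v') : ((c, A') : C × D) ⟶ (c, B')) by
        rw [← F.map_comp, ← F.map_comp]
        congr 1
        exact Prod.ext (by simp) hu')))) :
    Nonempty (IsLimit (Fork.ofι
      (F.map ((e, e') : ((E₁, E₂) : C × D) ⟶ (A, A')))
      (show F.map ((e, e') : ((E₁, E₂) : C × D) ⟶ (A, A')) ≫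
            F.map ((u, u') : ((A, A') : C × D) ⟶ (B, B')) =
          F.map ((e, e') : ((E₁, E₂) : C × D) ⟶ (A, A')) ≫
            F.map ((v, v') : ((A, A') : C × D) ⟶ (B, B')) by
        rw [← F.map_comp, ← F.map_comp]
        congr 1
        exact Prod.ext hu hu'))) := by
  have comp : ∀ {a b c : C} {a' b' c' : D} (f : a ⟶ b) (g : b ⟶ c) (f' : a' ⟶ b')
      (g' : b' ⟶ c') (h : a ⟶ c) (h' : a' ⟶ c'), f ≫ g = h → f' ≫ g' = h' →
      F.map ((f, f') : ((a, a') : C × D) ⟶ (b, b')) ≫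
        F.map ((g, g') : ((b, b') : C × D) ⟶ (c, c')) =
          F.map ((h, h') : ((a, a') : C × D) ⟶ (c, c')) := by
    rintro a b c a' b' c' f g f' g' _ _ rfl rfl
    exact (F.map_comp _ _).symm
  obtain ⟨hE₁⟩ := hF₁ E₂
  obtain ⟨hE₂⟩ := hF₂ A
  obtain ⟨hB⟩ := hF₂ B
  have hee' := comp e (𝟙 A) (𝟙 E₂) e' e e' (by simp) (by simp)
  refine ⟨Fork.IsLimit.mk' _ fun t ↦ ?_⟩
  have ht := t.condition
  -- the common retractions separate the two variables
  have ht₁ : t.ι ≫ F.map ((u, 𝟙 A') : ((A, A') : C × D) ⟶ (B, A')) =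
      t.ι ≫ F.map ((v, 𝟙 A') : ((A, A') : C × D) ⟶ (B, A')) := by
    rw [← comp u (𝟙 B) u' r' _ _ (by simp) hr₁', ← comp v (𝟙 B) v' r' _ _ (by simp) hr₂',
      reassoc_of% ht]
  have ht₂ : t.ι ≫ F.map ((𝟙 A, u') : ((A, A') : C × D) ⟶ (A, B')) =
      t.ι ≫ F.map ((𝟙 A, v') : ((A, A') : C × D) ⟶ (A, B')) := by
    rw [← comp u r u' (𝟙 B') _ _ hr₁ (by simp), ← comp v r v' (𝟙 B') _ _ hr₂ (by simp),
      reassoc_of% ht]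
  obtain ⟨s, hs⟩ := Fork.IsLimit.lift' hE₂ t.ι ht₂
  replace hs : s ≫ F.map ((𝟙 A, e') : ((A, E₂) : C × D) ⟶ (A, A')) = t.ι := hs
  have hs' : s ≫ F.map ((u, 𝟙 E₂) : ((A, E₂) : C × D) ⟶ (B, E₂)) =
      s ≫ F.map ((v, 𝟙 E₂) : ((A, E₂) : C × D) ⟶ (B, E₂)) := by
    refine Fork.IsLimit.hom_ext hB ?_
    simp only [Fork.ι_ofι, Category.assoc]
    rw [comp u (𝟙 B) (𝟙 E₂) e' u e' (by simp) (by simp),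
      comp v (𝟙 B) (𝟙 E₂) e' v e' (by simp) (by simp),
      ← comp (𝟙 A) u e' (𝟙 A') u e' (by simp) (by simp),
      ← comp (𝟙 A) v e' (𝟙 A') v e' (by simp) (by simp), reassoc_of% hs, reassoc_of% hs, ht₁]
  obtain ⟨l, hl⟩ := Fork.IsLimit.lift' hE₁ s hs'
  replace hl : l ≫ F.map ((e, 𝟙 E₂) : ((E₁, E₂) : C × D) ⟶ (A, E₂)) = s := hl
  refine ⟨l, ?_, fun {m} hm ↦ ?_⟩
  · change l ≫ F.map ((e, e') : ((E₁, E₂) : C × D) ⟶ (A, A')) = t.ι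
    rw [← hee', reassoc_of% hl, hs]
  · change t.pt ⟶ F.obj (E₁, E₂) at m
    change m ≫ F.map ((e, e') : ((E₁, E₂) : C × D) ⟶ (A, A')) = t.ι at hm
    rw [← hee', ← hs, ← hl] at hm
    refine Fork.IsLimit.hom_ext hE₁ (Fork.IsLimit.hom_ext hE₂ ?_)
    simpa only [Fork.ι_ofι, Category.assoc] using hm
end
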